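/- Proposition 2 (first claim): Let A : Ω×ℝ≥0 → [0,∞) be 𝒬-measurable, where 𝒬 is the predictable σ-algebra of the filtration (ℋ_t)_{t≥0}. Then there exists a 𝒟⊗𝒟⊗ℬ(ℝ≥0)-measurable function H : D×D×ℝ≥0 → [0,∞) such that A(ω,t) = H(X_·(ω), Z_·(ω), t) for all (ω,t) outside a P-evanescent set, and such that for P-a.s. ω̃ ∈ Ω held fixed, the map (ω,t) ↦ H(X_·(ω̃), Z_·(ω), t) is 𝒫^Z-measurable. -/

import Mathlib

open MeasureTheory Filter Topology Set
open scoped NNReal ENNReal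

noncomputable section

/-- A real-valued function on `ℝ≥0` is càdlàg: right-continuous with left limits. -/
def IsCadlag (u : ℝ≥0 → ℝ) : Prop :=
  (∀ t : ℝ≥0, ContinuousWithinAt u (Set.Ici t) t) ∧
  (∀ t : ℝ≥0, 0 < t → ∃ l : ℝ, Tendsto u (𝓝[<] t) (𝓝 l))

/-- `D`, the space of real-valued càdlàg functions on `ℝ≥0`. -/
def D : Type := {u : ℝ≥0 → ℝ // IsCadlag u}

/-- The σ-algebra `𝒟` on `D` generated by the evaluation maps `u ↦ u s`. -/
instance : MeasurableSpace D :=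
  ⨆ s : ℝ≥0, MeasurableSpace.comap (fun u : D => u.1 s) inferInstance

variable {Ω : Type*} {E : Type*}

/-- The σ-algebra generated by the `μ`-null sets (used for the augmentation `·^P`). -/
def nullSets [MeasurableSpace Ω] (μ : Measure Ω) : MeasurableSpace Ω :=
  MeasurableSpace.generateFrom {s : Set Ω | μ s = 0}

/-- The raw canonical filtration `σ(Y_s : s ≤ t)` of a process `Y`. -/
def natF [MeasurableSpace E] (Y : ℝ≥0 → Ω → E) (t : ℝ≥0) : MeasurableSpace Ω :=
  ⨆ s ∈ Set.Iic t, MeasurableSpace.comap (Y s) inferInstance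

/-- `ℱ^Y_t`: the right-continuous `P`-completed canonical filtration of `Y`. -/
def rcF [MeasurableSpace Ω] [MeasurableSpace E] (μ : Measure Ω) (Y : ℝ≥0 → Ω → E)
    (t : ℝ≥0) : MeasurableSpace Ω :=
  ⨅ u ∈ Set.Ioi t, (natF Y u ⊔ nullSets μ)

/-- `ℱ^Y_∞ := σ(⋃ t, ℱ^Y_t)`. -/
def rcFinf [MeasurableSpace Ω] [MeasurableSpace E] (μ : Measure Ω) (Y : ℝ≥0 → Ω → E) :
    MeasurableSpace Ω :=
  ⨆ t : ℝ≥0, rcF μ Y t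

/-- The σ-algebra generated by the whole process `Y`. -/
def sigmaProc [MeasurableSpace E] (Y : ℝ≥0 → Ω → E) : MeasurableSpace Ω :=
  ⨆ s : ℝ≥0, MeasurableSpace.comap (Y s) inferInstance

/-- `ℋ_t := (ℱ^X_∞ ∨ ℱ^Z_t)^P`. -/
def Hfilt [MeasurableSpace Ω] (μ : Measure Ω) (X : ℝ≥0 → Ω → ℝ) (Z : ℝ≥0 → Ω → ℝ≥0)
    (t : ℝ≥0) : MeasurableSpace Ω :=
  (rcFinf μ X ⊔ rcF μ Z t) ⊔ nullSets μ

/-- `ℱ_t := (ℱ^{X_Z}_t ∨ ℱ^Z_t)^P`, where `(X_Z)_t ω := X (Z t ω) ω`. -/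
def Ffilt [MeasurableSpace Ω] (μ : Measure Ω) (X : ℝ≥0 → Ω → ℝ) (Z : ℝ≥0 → Ω → ℝ≥0)
    (t : ℝ≥0) : MeasurableSpace Ω :=
  (rcF μ (fun u ω => X (Z u ω) ω) t ⊔ rcF μ Z t) ⊔ nullSets μ

/-- The predictable σ-algebra of a filtration `F`: the σ-algebra on `Ω × ℝ≥0`
generated by all left-continuous `F`-adapted processes. -/
def predSigma [MeasurableSpace Ω] (F : ℝ≥0 → MeasurableSpace Ω) :
    MeasurableSpace (Ω × ℝ≥0) :=
  ⨆ f ∈ {f : Ω × ℝ≥0 → ℝ |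
      (∀ ω t, ContinuousWithinAt (fun s => f (ω, s)) (Set.Iio t) t) ∧
      ∀ t, Measurable[F t] fun ω => f (ω, t)},
    MeasurableSpace.comap f inferInstance

/-- A function measurable up to a σ-filter with respect to a pulled-back σ-algebra
factors, up to that filter, through the map along which one pulls back. -/
theorem exists_measurable_comp_eventuallyEq {α β : Type*} {mβ : MeasurableSpace β} {g : α → β}
    {l : Filter α} [CountableInterFilter l] {f : α → ℝ≥0∞}
    (hf : Measurable[eventuallyMeasurableSpace (mβ.comap g) l] f) :
    ∃ H : β → ℝ≥0∞, Measurable H ∧ f =ᶠ[l] H ∘ g := by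
  let mα := eventuallyMeasurableSpace (mβ.comap g) l
  refine Measurable.ennreal_induction (motive := fun f => ∃ H : β → ℝ≥0∞,
    Measurable H ∧ f =ᶠ[l] H ∘ g) ?_ ?_ ?_ hf
  · rintro c s ⟨t, ⟨K, hK, rfl⟩, hst⟩
    refine ⟨K.indicator fun _ => c, measurable_const.indicator hK, ?_⟩
    filter_upwards [hst.mem_iff] with a ha
    by_cases h : a ∈ s <;> simp_all [Set.indicator]
  · rintro f₁ f₂ - - - ⟨H₁, hH₁, h₁⟩ ⟨H₂, hH₂, h₂⟩
    exact ⟨H₁ + H₂, hH₁.add hH₂, h₁.add h₂⟩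
  · intro f _ _ h
    choose H hH hfH using h
    refine ⟨fun b => ⨆ n, H n b, Measurable.iSup hH, ?_⟩
    filter_upwards [eventually_countable_forall.2 hfH] with a ha
    simp [ha]

theorem measurableSet_prod_of_subset_Ioi {F : ℝ≥0 → MeasurableSpace Ω}
    {G : MeasurableSpace (Ω × ℝ≥0)}
    (h : ∀ s B, MeasurableSet[F s] B → MeasurableSet[G] (B ×ˢ Ioi s))
    {s : ℝ≥0} {B : Set Ω} (hB : MeasurableSet[F s] B) {T : Set ℝ≥0} (hT : MeasurableSet T)
    (hTs : T ⊆ Ioi s) : MeasurableSet[G] (B ×ˢ T) := by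
  have hsnd : Measurable[G] (Prod.snd : Ω × ℝ≥0 → ℝ≥0) := by
    refine measurable_of_Ioi fun u => ?_
    have := h u univ MeasurableSet.univ
    rwa [univ_prod] at this
  have : B ×ˢ T = B ×ˢ Ioi s ∩ Prod.snd ⁻¹' T := by
    ext ⟨ω, t⟩
    simp only [mem_prod, mem_inter_iff, mem_preimage]
    exact ⟨fun hp => ⟨⟨hp.1, hTs hp.2⟩, hp.2⟩, fun hp => ⟨hp.1.1, hp.2⟩⟩
  rw [this]
  exact (h s B hB).inter (hsnd hT)

/-- The largest point of the grid of mesh `1 / (n + 1)` strictly below `t` (and `0` if `t = 0`)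
has index `gridIndex n t`. -/
def gridIndex (n : ℕ) (t : ℝ≥0) : ℕ := ⌈((n : ℝ≥0) + 1) * t⌉₊ - 1

theorem measurable_gridIndex (n : ℕ) : Measurable (gridIndex n) := by
  have h : Measurable fun k : ℕ => k - 1 := measurable_from_top
  exact h.comp (Nat.measurable_ceil.comp (measurable_const.mul measurable_id))

theorem gridIndex_div_lt (n : ℕ) {t : ℝ≥0} (ht : 0 < t) :
    (gridIndex n t : ℝ≥0) / (n + 1) < t := by
  have hn : (0 : ℝ≥0) < n + 1 := by positivity
  have hc : 0 < ⌈((n : ℝ≥0) + 1) * t⌉₊ := Nat.ceil_pos.2 (by positivity)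
  rw [div_lt_iff₀ hn, mul_comm]
  exact Nat.lt_ceil.1 (by unfold gridIndex; omega)

theorem le_gridIndex_add_one_div (n : ℕ) (t : ℝ≥0) :
    t ≤ (gridIndex n t : ℝ≥0) / (n + 1) + 1 / (n + 1) := by
  have hn : (0 : ℝ≥0) < n + 1 := by positivity
  rw [← add_div, le_div_iff₀ hn, mul_comm]
  refine (Nat.le_ceil _).trans ?_
  have : ⌈((n : ℝ≥0) + 1) * t⌉₊ ≤ gridIndex n t + 1 := by unfold gridIndex; omega
  exact_mod_cast this

theorem tendsto_gridIndex_div {t : ℝ≥0} (ht : 0 < t) :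
    Tendsto (fun n : ℕ => (gridIndex n t : ℝ≥0) / (n + 1)) atTop (𝓝[<] t) := by
  refine tendsto_nhdsWithin_iff.2 ⟨?_, Eventually.of_forall fun n => gridIndex_div_lt n ht⟩
  have h1 : Tendsto (fun n : ℕ => t - 1 / ((n : ℝ≥0) + 1)) atTop (𝓝 t) := by
    simpa using (tendsto_const_nhds (x := t)).sub
      (tendsto_one_div_add_atTop_nhds_zero_nat (𝕜 := ℝ≥0))
  refine tendsto_of_tendsto_of_tendsto_of_le_of_le h1 tendsto_const_nhds (fun n => ?_)
    fun n => (gridIndex_div_lt n ht).le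
  exact tsub_le_iff_right.2 (le_gridIndex_add_one_div n t)

section Predictable

variable [MeasurableSpace Ω] {F : ℝ≥0 → MeasurableSpace Ω}

/-- The predictable σ-algebra is generated by the predictable rectangles. -/
theorem predSigma_le {G : MeasurableSpace (Ω × ℝ≥0)}
    (h : ∀ s B, MeasurableSet[F s] B → MeasurableSet[G] (B ×ˢ Ioi s))
    (h0 : ∀ B, MeasurableSet[F 0] B → MeasurableSet[G] (B ×ˢ {0})) :
    predSigma F ≤ G := by
  refine iSup₂_le fun f hf => Measurable.comap_le ?_
  obtain ⟨hleft, hadapt⟩ := hf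
  refine measurable_of_tendsto_metrizable
    (f := fun (n : ℕ) p => f (p.1, (gridIndex n p.2 : ℝ≥0) / (n + 1))) (fun n => ?_) ?_
  · intro U hU
    have : (fun p : Ω × ℝ≥0 => f (p.1, (gridIndex n p.2 : ℝ≥0) / (n + 1))) ⁻¹' U =
        ((fun ω => f (ω, 0)) ⁻¹' U) ×ˢ {0} ∪
        ⋃ k : ℕ, ((fun ω => f (ω, (k : ℝ≥0) / (n + 1))) ⁻¹' U) ×ˢ
          (gridIndex n ⁻¹' {k} ∩ Ioi ((k : ℝ≥0) / (n + 1))) := by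
      ext ⟨ω, t⟩
      rcases eq_or_lt_of_le (zero_le (a := t)) with rfl | ht
      · simp [gridIndex]
      · simp only [mem_preimage, mem_union, mem_prod, mem_singleton_iff, mem_iUnion, mem_inter_iff,
          mem_Ioi, ht.ne', and_false, false_or]
        constructor
        · exact fun hp => ⟨_, hp, rfl, gridIndex_div_lt n ht⟩
        · rintro ⟨k, hp, rfl, -⟩
          exact hp
    rw [this]
    refine (h0 _ (hadapt 0 hU)).union (MeasurableSet.iUnion fun k => ?_)
    exact measurableSet_prod_of_subset_Ioi h (hadapt _ hU)
      ((measurable_gridIndex n (measurableSet_singleton k)).inter measurableSet_Ioi)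
      inter_subset_right
  · refine tendsto_pi_nhds.2 fun ⟨ω, t⟩ => ?_
    rcases eq_or_lt_of_le (zero_le (a := t)) with rfl | ht
    · simp [gridIndex]
    · exact (hleft ω t).tendsto.comp (tendsto_gridIndex_div ht)

theorem measurableSet_predSigma_of_indicator {S : Set (Ω × ℝ≥0)}
    (hleft : ∀ ω t, ContinuousWithinAt (fun s => S.indicator (fun _ => (1 : ℝ)) (ω, s)) (Iio t) t)
    (hadapt : ∀ t, MeasurableSet[F t] {ω | (ω, t) ∈ S}) : MeasurableSet[predSigma F] S := by
  have hle : MeasurableSpace.comap (S.indicator fun _ => (1 : ℝ)) inferInstance ≤ predSigma F := by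
    refine le_iSup₂_of_le (S.indicator fun _ => (1 : ℝ)) ⟨hleft, fun t => ?_⟩ le_rfl
    exact (measurable_const (a := (1 : ℝ))).indicator (hadapt t)
  refine hle _ ⟨{1}, measurableSet_singleton 1, ?_⟩
  ext p
  by_cases hp : p ∈ S <;> simp [hp]

theorem measurableSet_predSigma_prod_Ioi (hF : Monotone F) {s : ℝ≥0} {B : Set Ω}
    (hB : MeasurableSet[F s] B) : MeasurableSet[predSigma F] (B ×ˢ Ioi s) := by
  refine measurableSet_predSigma_of_indicator (fun ω t => ?_) fun t => ?_
  · rcases lt_or_ge s t with hst | hst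
    · refine ContinuousAt.continuousWithinAt (ContinuousAt.congr (f := fun _ =>
        B.indicator (fun _ => (1 : ℝ)) ω) continuousAt_const ?_)
      filter_upwards [Ioi_mem_nhds hst] with u hu
      have hu' : s < u := hu
      by_cases hω : ω ∈ B <;> simp [hω, hu']
    · refine (continuousWithinAt_const (b := (0 : ℝ))).congr (fun u hu => ?_) ?_
      · have : ¬ s < u := not_lt.2 ((le_of_lt hu).trans hst)
        simp [this]
      · simp [hst]
  · by_cases hst : s < t
    · simpa [hst] using hF hst.le B hB
    · simp [hst]

theorem measurableSet_predSigma_prod_zero {B : Set Ω} (hB : MeasurableSet[F 0] B) :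
    MeasurableSet[predSigma F] (B ×ˢ {(0 : ℝ≥0)}) := by
  refine measurableSet_predSigma_of_indicator (fun ω t => ?_) fun t => ?_
  · rcases eq_or_lt_of_le (zero_le (a := t)) with rfl | ht
    · have : Iio (0 : ℝ≥0) = ∅ := by ext; simp
      rw [this]
      simp [ContinuousWithinAt]
    · refine ContinuousAt.continuousWithinAt (ContinuousAt.congr (f := fun _ => (0 : ℝ))
        continuousAt_const ?_)
      filter_upwards [Ioi_mem_nhds ht] with u hu
      have : u ≠ 0 := (show 0 < u from hu).ne'
      simp [this]
  · rcases eq_or_ne t 0 with rfl | ht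
    · simpa using hB
    · simp [ht]

end Predictable

section Filtrations

theorem nullSets_le_eventuallyMeasurableSpace (m : MeasurableSpace Ω)
    [MeasurableSpace Ω] {μ : Measure Ω} :
    nullSets μ ≤ eventuallyMeasurableSpace m (ae μ) := by
  refine MeasurableSpace.generateFrom_le fun s hs => ⟨∅, @MeasurableSet.empty _ m, ?_⟩
  exact ae_eq_empty.2 hs

variable [MeasurableSpace Ω] {μ : Measure Ω}

theorem rcF_mono [MeasurableSpace E] (Y : ℝ≥0 → Ω → E) : Monotone (rcF μ Y) :=
  fun _ _ hst => biInf_mono fun _ hu => lt_of_le_of_lt hst hu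

theorem nullSets_le_rcF [MeasurableSpace E] (Y : ℝ≥0 → Ω → E) (t : ℝ≥0) :
    nullSets μ ≤ rcF μ Y t :=
  le_iInf₂ fun _ _ => le_sup_right

theorem rcF_le_sigmaProc_sup_nullSets [MeasurableSpace E] (Y : ℝ≥0 → Ω → E) (t : ℝ≥0) :
    rcF μ Y t ≤ sigmaProc Y ⊔ nullSets μ :=
  (iInf₂_le (t + 1) (show t < t + 1 by simp)).trans
    (sup_le_sup_right (iSup₂_le fun s _ => le_iSup (fun s => MeasurableSpace.comap (Y s) _) s) _)

theorem rcF_le_eventuallyMeasurableSpace [MeasurableSpace E] (Y : ℝ≥0 → Ω → E) (t : ℝ≥0) :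
    rcF μ Y t ≤ eventuallyMeasurableSpace (sigmaProc Y) (ae μ) :=
  (rcF_le_sigmaProc_sup_nullSets Y t).trans
    (sup_le le_eventuallyMeasurableSpace (nullSets_le_eventuallyMeasurableSpace _))

theorem measurableSet_rcF_congr [MeasurableSpace E] {Y : ℝ≥0 → Ω → E} {t : ℝ≥0} {B C : Set Ω}
    (hB : MeasurableSet[rcF μ Y t] B) (hBC : B =ᵐ[μ] C) : MeasurableSet[rcF μ Y t] C := by
  have hnull : ∀ s, μ s = 0 → MeasurableSet[rcF μ Y t] s := fun s hs =>
    nullSets_le_rcF Y t s (MeasurableSpace.measurableSet_generateFrom hs)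
  have : C = B \ (B \ C) ∪ C \ B := by
    ext ω; simp only [mem_union, Set.mem_sdiff]; tauto
  rw [this]
  exact (hB.diff (hnull _ (ae_le_set.1 hBC.le))).union (hnull _ (ae_le_set.1 hBC.symm.le))

end Filtrations

theorem measurable_D_apply (s : ℝ≥0) : Measurable fun u : D => u.1 s :=
  Measurable.of_comap_le (le_iSup (fun s => MeasurableSpace.comap (fun u : D => u.1 s) _) s)

/-- Sets of pairs of paths whose sections in the first path, pulled back along a random second
path `z`, belong to `m`. -/
abbrev pairSigma (x z : Ω → D) (m : MeasurableSpace Ω) : MeasurableSpace (D × D) :=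
  Prod.instMeasurableSpace ⊓ ⨅ ω', m.map fun ω => (x ω', z ω)

theorem measurableSet_pairSigma {x z : Ω → D} {m : MeasurableSpace Ω} {K : Set (D × D)} :
    MeasurableSet[pairSigma x z m] K ↔
      MeasurableSet K ∧ ∀ ω', MeasurableSet[m] ((fun ω => (x ω', z ω)) ⁻¹' K) := by
  rw [MeasurableSpace.measurableSet_inf, MeasurableSpace.measurableSet_iInf]
  rfl

/-- Sets of pairs of paths and times whose sections in the first path, pulled back along a random
second path `z`, belong to `m`. -/
abbrev tripleSigma (x z : Ω → D) (m : MeasurableSpace (Ω × ℝ≥0)) :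
    MeasurableSpace (D × D × ℝ≥0) :=
  Prod.instMeasurableSpace ⊓ ⨅ ω', m.map fun p => (x ω', z p.1, p.2)

theorem measurableSet_tripleSigma {x z : Ω → D} {m : MeasurableSpace (Ω × ℝ≥0)}
    {K : Set (D × D × ℝ≥0)} :
    MeasurableSet[tripleSigma x z m] K ↔
      MeasurableSet K ∧
        ∀ ω', MeasurableSet[m] ((fun p : Ω × ℝ≥0 => (x ω', z p.1, p.2)) ⁻¹' K) := by
  rw [MeasurableSpace.measurableSet_inf, MeasurableSpace.measurableSet_iInf]
  rfl

section SectionMeasurable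

variable [MeasurableSpace Ω] {μ : Measure Ω}

theorem Hfilt_le_eventuallyMeasurableSpace {X : ℝ≥0 → Ω → ℝ} {Z : ℝ≥0 → Ω → ℝ≥0} {x z : Ω → D}
    (hx : ∀ ω s, (x ω).1 s = X s ω) (hz : ∀ ω s, (z ω).1 s = Z s ω) (s : ℝ≥0) :
    Hfilt μ X Z s ≤ eventuallyMeasurableSpace
      ((pairSigma x z (rcF μ Z s)).comap fun ω => (x ω, z ω)) (ae μ) := by
  have hXx : sigmaProc X ≤ MeasurableSpace.comap x inferInstance := by
    refine iSup_le fun t => Measurable.comap_le ?_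
    have : X t = (fun u : D => u.1 t) ∘ x := funext fun ω => (hx ω t).symm
    rw [this]
    exact (measurable_D_apply t).comp (comap_measurable x)
  have hZz : sigmaProc Z ≤ MeasurableSpace.comap z inferInstance := by
    refine iSup_le fun t => Measurable.comap_le ?_
    have : Z t = (fun u : D => (u.1 t).toNNReal) ∘ z := funext fun ω => by simp [hz]
    rw [this]
    exact (measurable_D_apply t).real_toNNReal.comp (comap_measurable z)
  refine sup_le (sup_le (iSup_le fun t => ?_) ?_) (nullSets_le_eventuallyMeasurableSpace _)
  · intro B hB
    obtain ⟨C, hC, hBC⟩ := rcF_le_eventuallyMeasurableSpace X t B hB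
    obtain ⟨K, hK, rfl⟩ := hXx C hC
    refine ⟨_, ⟨Prod.fst ⁻¹' K, measurableSet_pairSigma.2
      ⟨measurable_fst hK, fun ω' => ?_⟩, rfl⟩, hBC⟩
    exact @MeasurableSet.const _ (rcF μ Z s) (x ω' ∈ K)
  · intro B hB
    obtain ⟨C, hC, hBC⟩ := rcF_le_eventuallyMeasurableSpace Z s B hB
    obtain ⟨K, hK, rfl⟩ := hZz C hC
    exact ⟨_, ⟨Prod.snd ⁻¹' K, measurableSet_pairSigma.2
      ⟨measurable_snd hK, fun _ => measurableSet_rcF_congr hB hBC⟩, rfl⟩, hBC⟩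

/-- Rectangles over events of `Hfilt` inherit the section property, provided rectangles over
events of `rcF` are predictable. -/
theorem measurableSet_prod_of_Hfilt {X : ℝ≥0 → Ω → ℝ} {Z : ℝ≥0 → Ω → ℝ≥0} {x z : Ω → D}
    (hx : ∀ ω s, (x ω).1 s = X s ω) (hz : ∀ ω s, (z ω).1 s = Z s ω) {s : ℝ≥0} {T : Set ℝ≥0}
    (hT : MeasurableSet T) {m : MeasurableSpace (Ω × ℝ≥0)}
    (hm : ∀ C, MeasurableSet[rcF μ Z s] C → MeasurableSet[m] (C ×ˢ T))
    {B : Set Ω} (hB : MeasurableSet[Hfilt μ X Z s] B) :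
    MeasurableSet[eventuallyMeasurableSpace
      ((tripleSigma x z m).comap fun p => (x p.1, z p.1, p.2))
      ((ae μ).comap Prod.fst)] (B ×ˢ T) := by
  obtain ⟨_, ⟨K, hK, rfl⟩, hBK⟩ := Hfilt_le_eventuallyMeasurableSpace hx hz s B hB
  rw [measurableSet_pairSigma] at hK
  refine ⟨_, ⟨{q | (q.1, q.2.1) ∈ K ∧ q.2.2 ∈ T},
    measurableSet_tripleSigma.2 ⟨?_, fun ω' => hm _ (hK.2 ω')⟩, rfl⟩, ?_⟩
  · have h₁ : Measurable fun q : D × D × ℝ≥0 => (q.1, q.2.1) := by fun_prop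
    have h₂ : Measurable fun q : D × D × ℝ≥0 => q.2.2 := by fun_prop
    exact (h₁ hK.1).inter (h₂ hT)
  · refine eventuallyEq_set.2 ((hBK.mem_iff.comap Prod.fst).mono fun p hp => ?_)
    simp only [mem_prod, hp, mem_preimage, mem_ofPred_eq]

end SectionMeasurable

/-- Proposition 2, first claim: `𝒬 = predSigma (ℋ_·)`,
`𝒫^Z = predSigma (ℱ^Z_·)`; evanescence is expressed by a `μ`-null set `N` of `ω`'s
outside of which the identification holds for all `t`. -/
theorem stmt_5 [MeasurableSpace Ω] (μ : Measure Ω) [IsProbabilityMeasure μ] [μ.IsComplete]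
    (X : ℝ≥0 → Ω → ℝ) (Z : ℝ≥0 → Ω → ℝ≥0)
    (hXmeas : ∀ s, Measurable (X s)) (hZmeas : ∀ s, Measurable (Z s))
    (hX : ∀ ω, IsCadlag fun s => X s ω)
    (hZ : ∀ ω, IsCadlag fun s => (Z s ω : ℝ))
    (hZmono : ∀ ω, Monotone fun s => Z s ω)
    (hindep : ProbabilityTheory.Indep (sigmaProc X) (sigmaProc Z) μ)
    (A : Ω × ℝ≥0 → ℝ) (hA0 : ∀ p, 0 ≤ A p)
    (hA : Measurable[predSigma (Hfilt μ X Z)] A) :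
    ∃ H : D × D × ℝ≥0 → ℝ, Measurable H ∧ (∀ q, 0 ≤ H q) ∧
      (∃ N : Set Ω, μ N = 0 ∧ ∀ ω ∉ N, ∀ t : ℝ≥0,
        A (ω, t) = H (⟨fun s => X s ω, hX ω⟩, ⟨fun s => (Z s ω : ℝ), hZ ω⟩, t)) ∧
      (∀ᵐ ω' ∂μ, Measurable[predSigma (rcF μ Z)]
        fun p : Ω × ℝ≥0 =>
          H (⟨fun s => X s ω', hX ω'⟩, ⟨fun s => (Z s p.1 : ℝ), hZ p.1⟩, p.2)) := by
  let x : Ω → D := fun ω => ⟨fun s => X s ω, hX ω⟩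
  let z : Ω → D := fun ω => ⟨fun s => (Z s ω : ℝ), hZ ω⟩
  have hx : ∀ ω s, (x ω).1 s = X s ω := fun _ _ => rfl
  have hz : ∀ ω s, (z ω).1 s = Z s ω := fun _ _ => rfl
  have hle : predSigma (Hfilt μ X Z) ≤ eventuallyMeasurableSpace
      ((tripleSigma x z (predSigma (rcF μ Z))).comap fun p => (x p.1, z p.1, p.2))
      ((ae μ).comap Prod.fst) :=
    predSigma_le
      (fun _ _ => measurableSet_prod_of_Hfilt hx hz measurableSet_Ioi
        fun _ => measurableSet_predSigma_prod_Ioi (rcF_mono Z))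
      (fun _ => measurableSet_prod_of_Hfilt hx hz (measurableSet_singleton 0)
        fun _ => measurableSet_predSigma_prod_zero)
  obtain ⟨H, hH, hAH⟩ := exists_measurable_comp_eventuallyEq (hA.mono hle le_rfl).ennreal_ofReal
  refine ⟨fun q => (H q).toReal, ?_, fun q => ENNReal.toReal_nonneg, ?_,
    Eventually.of_forall fun ω' => ?_⟩
  · exact (show Measurable H from hH.mono inf_le_left le_rfl).ennreal_toReal
  · obtain ⟨S, hS, hSA⟩ := mem_comap.1 hAH
    refine ⟨Sᶜ, hS, fun ω hω t => ?_⟩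
    have h : ENNReal.ofReal (A (ω, t)) = H (x ω, z ω, t) := @hSA (ω, t) (not_notMem.1 hω)
    exact (by rw [← h, ENNReal.toReal_ofReal (hA0 _)] : A (ω, t) = (H (x ω, z ω, t)).toReal)
  · have h : Measurable[predSigma (rcF μ Z)] fun p : Ω × ℝ≥0 => H (x ω', z p.1, p.2) :=
      fun U hU => (measurableSet_tripleSigma.1 (hH hU)).2 ω'
    exact h.ennreal_toReal
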